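/- arXiv:1606.03593 — 8 statements merged into one kernel-verified Lean document; each statement's English description precedes it below -/
import Mathlib

section
/- Let I and J be nonempty subspaces of 𝒜 and 𝔄 respectively. Then I × J is a left ideal of the amalgamated duplication 𝒜⋊𝔄 if and only if I is a left ideal of 𝒜, J is a left ideal of 𝔄, I is a left 𝔄-submodule of 𝒜 (i.e. 𝔄·I ⊆ I), and 𝒜·J ⊆ I. -/
noncomputable section

open ContinuousLinearMap

/-- `𝒜` is a Banach `𝔄`-bimodule with compatible actions: the left action `l` and right
action `r` are continuous bilinear maps satisfying the module axioms and the
compatibility conditions `β·(ab) = (β·a)b`, `(ab)·β = a(b·β)`, `a(β·b) = (a·β)b`. -/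
structure BiAction (A B : Type) [NonUnitalNormedRing A] [NormedSpace ℂ A]
    [IsScalarTower ℂ A A] [SMulCommClass ℂ A A]
    [NonUnitalNormedRing B] [NormedSpace ℂ B] [IsScalarTower ℂ B B] [SMulCommClass ℂ B B] :
    Type where
  l : B →L[ℂ] A →L[ℂ] A
  r : A →L[ℂ] B →L[ℂ] A
  l_mul : ∀ (β γ : B) (a : A), l (β * γ) a = l β (l γ a)
  r_mul : ∀ (a : A) (β γ : B), r a (β * γ) = r (r a β) γ
  lr_assoc : ∀ (β : B) (a : A) (γ : B), r (l β a) γ = l β (r a γ)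
  compat_l : ∀ (β : B) (a b : A), l β (a * b) = l β a * b
  compat_r : ∀ (a b : A) (β : B), r (a * b) β = a * r b β
  compat_m : ∀ (a : A) (β : B) (b : A), a * l β b = r a β * b

variable {A B : Type} [NonUnitalNormedRing A] [NormedSpace ℂ A]
    [IsScalarTower ℂ A A] [SMulCommClass ℂ A A]
    [NonUnitalNormedRing B] [NormedSpace ℂ B] [IsScalarTower ℂ B B] [SMulCommClass ℂ B B]

/-- The multiplication of the amalgamated duplication `𝒜 ⋊ 𝔄`:
`(a, β)(b, γ) = (ab + a·γ + β·b, βγ)`. -/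
def dupMul (σ : BiAction A B) (x y : A × B) : A × B :=
  (x.1 * y.1 + σ.r x.1 y.2 + σ.l x.2 y.1, x.2 * y.2)


/-- For nonempty subspaces `I ⊆ 𝒜` and `J ⊆ 𝔄`, the subspace `I × J` is a
left ideal of the amalgamated duplication `𝒜 ⋊ 𝔄` if and only if `I` is a left ideal of `𝒜`,
`J` is a left ideal of `𝔄`, `I` is a left `𝔄`-submodule of `𝒜` and `𝒜·J ⊆ I`. -/
theorem prod_isLeftIdeal_iff [CompleteSpace A] [CompleteSpace B]
    (σ : BiAction A B) (I : Submodule ℂ A) (J : Submodule ℂ B) :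
    (∀ x y : A × B, y ∈ I.prod J → dupMul σ x y ∈ I.prod J) ↔
      ((∀ a b : A, b ∈ I → a * b ∈ I) ∧ (∀ β γ : B, γ ∈ J → β * γ ∈ J) ∧
        (∀ (β : B) (a : A), a ∈ I → σ.l β a ∈ I) ∧
        (∀ (a : A) (γ : B), γ ∈ J → σ.r a γ ∈ I)) := by
  constructor
  · intro h
    refine ⟨fun a b hb => ?_, fun β γ hγ => ?_, fun β a ha => ?_, fun a γ hγ => ?_⟩
    · simpa [dupMul] using (h (a, 0) (b, 0) ⟨hb, J.zero_mem⟩).1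
    · simpa [dupMul] using (h (0, β) (0, γ) ⟨I.zero_mem, hγ⟩).2
    · simpa [dupMul] using (h (0, β) (a, 0) ⟨ha, J.zero_mem⟩).1
    · simpa [dupMul] using (h (a, 0) (0, γ) ⟨I.zero_mem, hγ⟩).1
  · rintro ⟨hI, hJ, hl, hr⟩ x y ⟨hy₁, hy₂⟩
    exact ⟨I.add_mem (I.add_mem (hI _ _ hy₁) (hr _ _ hy₂)) (hl _ _ hy₁), hJ _ _ hy₂⟩

end
end

section
/- Let N be a left ideal of the amalgamated duplication 𝒜⋊𝔄 containing {0} × 𝔄, and set I_N = {a ∈ 𝒜 : (a, β) ∈ N for some β ∈ 𝔄}. Then I_N is a left ideal of 𝒜 and N = I_N × 𝔄. -/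
noncomputable section

open ContinuousLinearMap

variable {A B : Type} [NonUnitalNormedRing A] [NormedSpace ℂ A]
    [IsScalarTower ℂ A A] [SMulCommClass ℂ A A]
    [NonUnitalNormedRing B] [NormedSpace ℂ B] [IsScalarTower ℂ B B] [SMulCommClass ℂ B B]

/-- A submodule of `V × W` containing `{0} × W` is saturated in the second coordinate. -/
theorem mk_mem_of_mk_mem {R V W : Type*} [Ring R] [AddCommGroup V] [Module R V]
    [AddCommGroup W] [Module R W] {N : Submodule R (V × W)} (hN : ∀ w : W, ((0 : V), w) ∈ N)
    {v : V} {w : W} (h : (v, w) ∈ N) (w' : W) : (v, w') ∈ N := by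
  simpa using N.add_mem h (hN (w' - w))

/-- If `N` is a left ideal of `𝒜 ⋊ 𝔄` containing `{0} × 𝔄`, and
`I_N = {a ∈ 𝒜 : (a, β) ∈ N for some β}`, then `I_N` is a left ideal of `𝒜` and
`N = I_N × 𝔄`. -/
theorem leftIdeal_containing_zero_prod_top [CompleteSpace A] [CompleteSpace B]
    (σ : BiAction A B) (N : Submodule ℂ (A × B))
    (hN : ∀ x y : A × B, y ∈ N → dupMul σ x y ∈ N)
    (hcont : ∀ β : B, ((0 : A), β) ∈ N) :
    ∃ I : Submodule ℂ A, (I : Set A) = {a : A | ∃ β : B, (a, β) ∈ N} ∧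
      (∀ a b : A, b ∈ I → a * b ∈ I) ∧ N = I.prod ⊤ := by
  refine ⟨N.map (LinearMap.fst ℂ A B), by ext a; simp, ?_, ?_⟩
  · rintro a _ ⟨⟨b, β⟩, h, rfl⟩
    exact ⟨(a * b, 0), by simpa [dupMul] using hN (a, 0) (b, 0) (mk_mem_of_mk_mem hcont h 0), rfl⟩
  · ext ⟨a, β⟩
    constructor
    · exact fun h => ⟨⟨_, h, rfl⟩, trivial⟩
    · rintro ⟨⟨⟨b, γ⟩, h, rfl⟩, -⟩
      exact mk_mem_of_mk_mem hcont h β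

end
end

section
/- A nonempty subspace J of 𝔄 is a maximal left ideal of 𝔄 if and only if 𝒜 × J is a maximal left ideal of the amalgamated duplication 𝒜⋊𝔄. -/
noncomputable section

open ContinuousLinearMap

variable {A B : Type} [NonUnitalNormedRing A] [NormedSpace ℂ A]
    [IsScalarTower ℂ A A] [SMulCommClass ℂ A A]
    [NonUnitalNormedRing B] [NormedSpace ℂ B] [IsScalarTower ℂ B B] [SMulCommClass ℂ B B]

variable [CompleteSpace A] [CompleteSpace B]

/-- `N` is a left ideal of the amalgamated duplication `𝒜 ⋊ 𝔄`. -/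
def IsLeftIdealDup (σ : BiAction A B) (N : Submodule ℂ (A × B)) : Prop :=
  ∀ x y : A × B, y ∈ N → dupMul σ x y ∈ N

/-- `N` is a maximal left ideal of the amalgamated duplication `𝒜 ⋊ 𝔄`. -/
def IsMaxLeftIdealDup (σ : BiAction A B) (N : Submodule ℂ (A × B)) : Prop :=
  IsLeftIdealDup σ N ∧ N ≠ ⊤ ∧
    ∀ N' : Submodule ℂ (A × B), IsLeftIdealDup σ N' → N < N' → N' = ⊤

/-- `I` is a left ideal of the Banach algebra `C`. -/
def IsLeftIdealAlg {C : Type} [NonUnitalNormedRing C] [NormedSpace ℂ C]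
    (I : Submodule ℂ C) : Prop :=
  ∀ c d : C, d ∈ I → c * d ∈ I

/-- `I` is a maximal left ideal of the Banach algebra `C`. -/
def IsMaxLeftIdealAlg {C : Type} [NonUnitalNormedRing C] [NormedSpace ℂ C]
    (I : Submodule ℂ C) : Prop :=
  IsLeftIdealAlg I ∧ I ≠ ⊤ ∧
    ∀ I' : Submodule ℂ C, IsLeftIdealAlg I' → I < I' → I' = ⊤

omit [CompleteSpace A] [CompleteSpace B] in
theorem isLeftIdealDup_top_prod_iff (σ : BiAction A B) (J : Submodule ℂ B) :
    IsLeftIdealDup σ ((⊤ : Submodule ℂ A).prod J) ↔ IsLeftIdealAlg J := by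
  refine ⟨fun h c d hd => ?_, fun h x y hy => ?_⟩
  · exact (Submodule.mem_prod.mp (h (0, c) (0, d) ⟨Submodule.mem_top, hd⟩)).2
  · exact ⟨Submodule.mem_top, h _ _ hy.2⟩

/-- A subspace of `E × F` containing `E × J` is of the form `E × K`. -/
theorem exists_eq_top_prod_of_le {R E F : Type*} [Ring R] [AddCommGroup E] [Module R E]
    [AddCommGroup F] [Module R F] {J : Submodule R F} {N : Submodule R (E × F)}
    (h : (⊤ : Submodule R E).prod J ≤ N) :
    ∃ K : Submodule R F, N = (⊤ : Submodule R E).prod K := by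
  refine ⟨N.comap (LinearMap.inr R E F), ?_⟩
  ext ⟨a, b⟩
  have ha : ((a, 0) : E × F) ∈ N := h ⟨Submodule.mem_top, J.zero_mem⟩
  simpa using (N.add_mem_iff_right ha (y := (0, b)))

theorem top_prod_le_top_prod_iff {R E F : Type*} [Ring R] [AddCommGroup E] [Module R E]
    [AddCommGroup F] [Module R F] {J K : Submodule R F} :
    (⊤ : Submodule R E).prod J ≤ (⊤ : Submodule R E).prod K ↔ J ≤ K := by
  refine ⟨fun h b hb => ?_, fun h => Submodule.prod_mono le_rfl h⟩
  exact (Submodule.mem_prod.mp (h (x := (0, b)) ⟨Submodule.mem_top, hb⟩)).2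

theorem top_prod_lt_top_prod_iff {R E F : Type*} [Ring R] [AddCommGroup E] [Module R E]
    [AddCommGroup F] [Module R F] {J K : Submodule R F} :
    (⊤ : Submodule R E).prod J < (⊤ : Submodule R E).prod K ↔ J < K := by
  simp only [lt_iff_le_not_ge, top_prod_le_top_prod_iff]

theorem top_prod_eq_top_iff {R E F : Type*} [Ring R] [AddCommGroup E] [Module R E]
    [AddCommGroup F] [Module R F] {J : Submodule R F} :
    (⊤ : Submodule R E).prod J = ⊤ ↔ J = ⊤ := by
  rw [← top_le_iff, ← Submodule.prod_top, top_prod_le_top_prod_iff, top_le_iff]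

/-- `J` is a maximal left ideal of `𝔄` if and only if `𝒜 × J` is a maximal
left ideal of the amalgamated duplication `𝒜 ⋊ 𝔄`. -/
theorem top_prod_maxLeftIdeal_iff (σ : BiAction A B) (J : Submodule ℂ B) :
    IsMaxLeftIdealAlg J ↔ IsMaxLeftIdealDup σ ((⊤ : Submodule ℂ A).prod J) := by
  unfold IsMaxLeftIdealAlg IsMaxLeftIdealDup
  rw [isLeftIdealDup_top_prod_iff, Ne, Ne, top_prod_eq_top_iff]
  refine and_congr_right fun _ => and_congr_right fun _ => ⟨fun h N hN hlt => ?_,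
    fun h K hK hlt => ?_⟩
  · obtain ⟨K, rfl⟩ := exists_eq_top_prod_of_le hlt.le
    exact top_prod_eq_top_iff.mpr
      (h K ((isLeftIdealDup_top_prod_iff σ K).mp hN) (top_prod_lt_top_prod_iff.mp hlt))
  · exact top_prod_eq_top_iff.mp
      (h _ ((isLeftIdealDup_top_prod_iff σ K).mpr hK) (top_prod_lt_top_prod_iff.mpr hlt))

end
end

section
/- A bounded linear operator T on the amalgamated duplication 𝒜⋊𝔄 is a left multiplier (T ∈ LM(𝒜⋊𝔄)) if and only if there exist a bounded left 𝔄-module map T¹_𝒜 : 𝒜 → 𝒜, a bounded left 𝔄-module map T¹_𝔄 : 𝔄 → 𝒜, a left multiplier T²_𝔄 ∈ LM(𝔄), and a bounded left 𝔄-module map T²_𝒜 : 𝒜 → 𝔄 such that for all a, b ∈ 𝒜 and β ∈ 𝔄: (i) T((a, β)) = (T¹_𝒜(a) + T¹_𝔄(β), T²_𝒜(a) + T²_𝔄(β)); (ii) T¹_𝒜(ab) = a T¹_𝒜(b) + a·T²_𝒜(b); (iii) T¹_𝒜(a·β) = a T¹_𝔄(β) + a·T²_𝔄(β); (iv) T²_𝒜(ab)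 = 0 and T²_𝒜(a·β) = 0. -/
noncomputable section

open ContinuousLinearMap

variable {A B : Type} [NonUnitalNormedRing A] [NormedSpace ℂ A]
    [IsScalarTower ℂ A A] [SMulCommClass ℂ A A]
    [NonUnitalNormedRing B] [NormedSpace ℂ B] [IsScalarTower ℂ B B] [SMulCommClass ℂ B B]

/-- A bounded linear operator `T` on `𝒜 ⋊ 𝔄` is a left multiplier if and
only if it decomposes as `T (a, β) = (T¹_𝒜 a + T¹_𝔄 β, T²_𝒜 a + T²_𝔄 β)` where `T¹_𝒜`,
`T¹_𝔄`, `T²_𝒜` are bounded left `𝔄`-module maps, `T²_𝔄` is a left multiplier of `𝔄`, and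
conditions (ii)–(iv) hold. -/
theorem leftMultiplier_dup_iff [CompleteSpace A] [CompleteSpace B]
    (σ : BiAction A B) (T : (A × B) →L[ℂ] (A × B)) :
    (∀ x y : A × B, T (dupMul σ x y) = dupMul σ x (T y)) ↔
      ∃ (T1A : A →L[ℂ] A) (T1B : B →L[ℂ] A) (T2B : B →L[ℂ] B) (T2A : A →L[ℂ] B),
        -- `T¹_𝒜 ∈ Hom_𝔄(𝒜, 𝒜)`
        (∀ (β : B) (a : A), T1A (σ.l β a) = σ.l β (T1A a)) ∧
        -- `T¹_𝔄 ∈ Hom_𝔄(𝔄, 𝒜)`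
        (∀ β γ : B, T1B (β * γ) = σ.l β (T1B γ)) ∧
        -- `T²_𝔄 ∈ LM(𝔄)`
        (∀ β γ : B, T2B (β * γ) = β * T2B γ) ∧
        -- `T²_𝒜 ∈ Hom_𝔄(𝒜, 𝔄)`
        (∀ (β : B) (a : A), T2A (σ.l β a) = β * T2A a) ∧
        -- (i)
        (∀ (a : A) (β : B), T (a, β) = (T1A a + T1B β, T2A a + T2B β)) ∧
        -- (ii)
        (∀ a b : A, T1A (a * b) = a * T1A b + σ.r a (T2A b)) ∧
        -- (iii)
        (∀ (a : A) (β : B), T1A (σ.r a β) = a * T1B β + σ.r a (T2B β)) ∧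
        -- (iv)
        (∀ a b : A, T2A (a * b) = 0) ∧ (∀ (a : A) (β : B), T2A (σ.r a β) = 0) := by
  constructor
  · intro h
    have hT (a : A) (β : B) : T (a, β) = T (a, 0) + T (0, β) := by
      rw [← map_add]; simp
    have hAA (a b : A) : T (a * b, 0) = (a * (T (b, 0)).1 + σ.r a (T (b, 0)).2, 0) := by
      simpa [dupMul] using h (a, 0) (b, 0)
    have hAB (a : A) (β : B) :
        T (σ.r a β, 0) = (a * (T (0, β)).1 + σ.r a (T (0, β)).2, 0) := by
      simpa [dupMul] using h (a, 0) (0, β)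
    have hBA (β : B) (a : A) : T (σ.l β a, 0) = (σ.l β (T (a, 0)).1, β * (T (a, 0)).2) := by
      simpa [dupMul] using h (0, β) (a, 0)
    have hBB (β γ : B) : T (0, β * γ) = (σ.l β (T (0, γ)).1, β * (T (0, γ)).2) := by
      simpa [dupMul] using h (0, β) (0, γ)
    refine ⟨(fst ℂ A B).comp (T.comp (inl ℂ A B)), (fst ℂ A B).comp (T.comp (inr ℂ A B)),
      (snd ℂ A B).comp (T.comp (inr ℂ A B)), (snd ℂ A B).comp (T.comp (inl ℂ A B)),
      ?_, ?_, ?_, ?_, ?_, ?_, ?_, ?_, ?_⟩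
    · intro β a; simp [hBA]
    · intro β γ; simp [hBB]
    · intro β γ; simp [hBB]
    · intro β a; simp [hBA]
    · intro a β; exact hT a β
    · intro a b; simp [hAA]
    · intro a β; simp [hAB]
    · intro a b; simp [hAA]
    · intro a β; simp [hAB]
  · rintro ⟨T1A, T1B, T2B, T2A, h1A, h1B, h2B, h2A, hT, hmul, hr, hmul0, hr0⟩ ⟨a, β⟩ ⟨b, γ⟩
    ext
    · simp only [dupMul, hT, map_add, mul_add, h1A, h1B, hmul, hr]
      abel
    · simp only [dupMul, hT, map_add, mul_add, h2A, h2B, hmul0, hr0, zero_add]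

end
end

section
/- Suppose that either the closed linear span of 𝒜² equals 𝒜 or the closed linear span of 𝒜·𝔄 equals 𝒜. Then a bounded linear operator T on 𝒜⋊𝔄 is a left multiplier if and only if there exist T¹_𝒜 which is both a bounded left 𝔄-module map 𝒜 → 𝒜 and a left multiplier of 𝒜, a bounded left 𝔄-module map T¹_𝔄 : 𝔄 → 𝒜, and a left multiplier T²_𝔄 ∈ LM(𝔄), such that T¹_𝒜(a·β) = a T¹_𝔄(β) + a·T²_𝔄(β) and T((a, β)) = (T¹_𝒜(a) + T¹_𝔄(β), T²_𝔄(β)) for all a ∈ 𝒜 and β ∈ 𝔄. -/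
noncomputable section

open ContinuousLinearMap

variable {A B : Type} [NonUnitalNormedRing A] [NormedSpace ℂ A]
    [IsScalarTower ℂ A A] [SMulCommClass ℂ A A]
    [NonUnitalNormedRing B] [NormedSpace ℂ B] [IsScalarTower ℂ B B] [SMulCommClass ℂ B B]

theorem ContinuousLinearMap.eq_zero_of_dense_span {E F : Type*} [NormedAddCommGroup E]
    [NormedSpace ℂ E] [NormedAddCommGroup F] [NormedSpace ℂ F] {s : Set E}
    (hs : (Submodule.span ℂ s).topologicalClosure = ⊤) {f : E →L[ℂ] F}
    (hf : ∀ x ∈ s, f x = 0) : f = 0 :=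
  ContinuousLinearMap.ext_on (Submodule.dense_iff_topologicalClosure_eq_top.mpr hs) hf

/-- If `⟨𝒜²⟩ = 𝒜` or `⟨𝒜·𝔄⟩ = 𝒜` (closed linear spans), then `T` is a left
multiplier of `𝒜 ⋊ 𝔄` if and only if `T (a, β) = (T¹_𝒜 a + T¹_𝔄 β, T²_𝔄 β)` where `T¹_𝒜` is a
bounded left `𝔄`-module map which is also a left multiplier of `𝒜`, `T¹_𝔄` is a bounded left
`𝔄`-module map, `T²_𝔄 ∈ LM(𝔄)`, and `T¹_𝒜(a·β) = a T¹_𝔄(β) + a·T²_𝔄(β)`. -/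
theorem leftMultiplier_dup_iff_of_span [CompleteSpace A] [CompleteSpace B]
    (σ : BiAction A B)
    (hspan :
      (Submodule.span ℂ {x : A | ∃ a b : A, x = a * b}).topologicalClosure = ⊤ ∨
      (Submodule.span ℂ {x : A | ∃ (a : A) (β : B), x = σ.r a β}).topologicalClosure = ⊤)
    (T : (A × B) →L[ℂ] (A × B)) :
    (∀ x y : A × B, T (dupMul σ x y) = dupMul σ x (T y)) ↔
      ∃ (T1A : A →L[ℂ] A) (T1B : B →L[ℂ] A) (T2B : B →L[ℂ] B),
        -- `T¹_𝒜 ∈ Hom_𝔄(𝒜, 𝒜) ∩ LM(𝒜)`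
        (∀ (β : B) (a : A), T1A (σ.l β a) = σ.l β (T1A a)) ∧
        (∀ a b : A, T1A (a * b) = a * T1A b) ∧
        -- `T¹_𝔄 ∈ Hom_𝔄(𝔄, 𝒜)`
        (∀ β γ : B, T1B (β * γ) = σ.l β (T1B γ)) ∧
        -- `T²_𝔄 ∈ LM(𝔄)`
        (∀ β γ : B, T2B (β * γ) = β * T2B γ) ∧
        (∀ (a : A) (β : B), T1A (σ.r a β) = a * T1B β + σ.r a (T2B β)) ∧
        (∀ (a : A) (β : B), T (a, β) = (T1A a + T1B β, T2B β)) := by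
  constructor
  · intro hT
    have hAA (a b : A) : T (a * b, 0) = (a * (T (b, 0)).1 + σ.r a (T (b, 0)).2, 0) := by
      simpa [dupMul] using hT (a, 0) (b, 0)
    have hAB (a : A) (β : B) :
        T (σ.r a β, 0) = (a * (T (0, β)).1 + σ.r a (T (0, β)).2, 0) := by
      simpa [dupMul] using hT (a, 0) (0, β)
    have hBA (β : B) (a : A) : T (σ.l β a, 0) = (σ.l β (T (a, 0)).1, β * (T (a, 0)).2) := by
      simpa [dupMul] using hT (0, β) (a, 0)
    have hBB (β γ : B) : T (0, β * γ) = (σ.l β (T (0, γ)).1, β * (T (0, γ)).2) := by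
      simpa [dupMul] using hT (0, β) (0, γ)
    have hzero : (snd ℂ A B ∘L T) ∘L inl ℂ A B = 0 := by
      rcases hspan with h | h
      · refine eq_zero_of_dense_span h ?_
        rintro _ ⟨a, b, rfl⟩
        simp [hAA]
      · refine eq_zero_of_dense_span h ?_
        rintro _ ⟨a, β, rfl⟩
        simp [hAB]
    have hsnd (a : A) : (T (a, 0)).2 = 0 := by
      simpa using DFunLike.congr_fun hzero a
    refine ⟨(fst ℂ A B ∘L T) ∘L inl ℂ A B, (fst ℂ A B ∘L T) ∘L inr ℂ A B,
      (snd ℂ A B ∘L T) ∘L inr ℂ A B, fun β a => ?_, fun a b => ?_, fun β γ => ?_,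
      fun β γ => ?_, fun a β => ?_, fun a β => ?_⟩
    · simp [hBA]
    · simp [hAA, hsnd]
    · simp [hBB]
    · simp [hBB]
    · simp [hAB]
    · have h : T (a, β) = T (a, 0) + T (0, β) := by simp [← map_add]
      ext <;> simp [h, hsnd]
  · rintro ⟨T1A, T1B, T2B, hl, hmul, hB, hBmul, hr, hT⟩ ⟨a, β⟩ ⟨b, γ⟩
    simp only [dupMul, hT, map_add, hl, hmul, hB, hBmul, hr, mul_add, Prod.mk.injEq, and_true]
    abel

end
end

section
/- If φ is a nonzero multiplicative linear functional on 𝒜, then there exists a unique linear functional φ̃ on 𝔄 which is either zero or a nonzero multiplicative linear functional, such that φ(a·β) = φ(β·a) = φ(a)φ̃(β) for all a ∈ 𝒜 and β ∈ 𝔄. Moreover, if the closed linear span of 𝒜·𝔄 equals 𝒜 or the closed linear span of 𝔄·𝒜 equals 𝒜, then φ̃ ≠ 0. -/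
noncomputable section

open ContinuousLinearMap

variable {A B : Type} [NonUnitalNormedRing A] [NormedSpace ℂ A]
    [IsScalarTower ℂ A A] [SMulCommClass ℂ A A]
    [NonUnitalNormedRing B] [NormedSpace ℂ B] [IsScalarTower ℂ B B] [SMulCommClass ℂ B B]

/-- If `φ` is a nonzero multiplicative continuous linear functional on `𝒜`,
then there is a unique continuous linear functional `φ̃` on `𝔄`, either zero or a nonzero
multiplicative functional, with `φ(a·β) = φ(β·a) = φ(a)φ̃(β)`; moreover if `⟨𝒜·𝔄⟩ = 𝒜` or
`⟨𝔄·𝒜⟩ = 𝒜` then `φ̃ ≠ 0`. -/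
theorem exists_unique_assoc_char [CompleteSpace A] [CompleteSpace B]
    (σ : BiAction A B) (φ : A →L[ℂ] ℂ) (hφ : φ ≠ 0)
    (hmul : ∀ a b : A, φ (a * b) = φ a * φ b) :
    ∃ ψ : B →L[ℂ] ℂ,
      (ψ = 0 ∨ (ψ ≠ 0 ∧ ∀ β γ : B, ψ (β * γ) = ψ β * ψ γ)) ∧
      (∀ (a : A) (β : B), φ (σ.r a β) = φ a * ψ β ∧ φ (σ.l β a) = φ a * ψ β) ∧
      (∀ ψ' : B →L[ℂ] ℂ,
        (ψ' = 0 ∨ (ψ' ≠ 0 ∧ ∀ β γ : B, ψ' (β * γ) = ψ' β * ψ' γ)) →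
        (∀ (a : A) (β : B), φ (σ.r a β) = φ a * ψ' β ∧ φ (σ.l β a) = φ a * ψ' β) →
        ψ' = ψ) ∧
      (((Submodule.span ℂ {x : A | ∃ (a : A) (β : B), x = σ.r a β}).topologicalClosure = ⊤ ∨
        (Submodule.span ℂ {x : A | ∃ (β : B) (a : A), x = σ.l β a}).topologicalClosure = ⊤) →
        ψ ≠ 0) := by
  obtain ⟨v, hv⟩ : ∃ v, φ v ≠ 0 := by
    by_contra! h
    exact hφ (ContinuousLinearMap.ext h)
  obtain ⟨u, hu⟩ : ∃ u, φ u = 1 := ⟨(φ v)⁻¹ • v, by simp [hv]⟩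
  have hr (a : A) (β : B) : φ (σ.r a β) = φ a * φ (σ.l β u) := by
    have h := congrArg φ (σ.compat_m a β u)
    rw [hmul, hmul, hu, mul_one] at h
    exact h.symm
  have hl (a : A) (β : B) : φ (σ.l β a) = φ a * φ (σ.l β u) := by
    have h := congrArg φ (σ.compat_m u β a)
    rw [hmul, hmul, hr, hu, one_mul, one_mul] at h
    rw [h, mul_comm]
  refine ⟨φ.comp (σ.l.flip u), ?_, fun a β => ⟨hr a β, hl a β⟩, fun ψ' _ h => ?_, ?_⟩
  · refine or_iff_not_imp_left.mpr fun h => ⟨h, fun β γ => ?_⟩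
    simp only [ContinuousLinearMap.comp_apply, ContinuousLinearMap.flip_apply]
    rw [σ.l_mul, hl, mul_comm]
  · ext β
    simpa [hu] using (h u β).2.symm
  · intro h hψ
    have hzero (β : B) : φ (σ.l β u) = 0 := DFunLike.congr_fun hψ β
    have eq_zero_of_dense_span (s : Set A) (hs : (Submodule.span ℂ s).topologicalClosure = ⊤)
        (h0 : Set.EqOn φ 0 s) : φ = 0 :=
      ContinuousLinearMap.ext_on (Submodule.dense_iff_topologicalClosure_eq_top.mpr hs) h0
    rcases h with h | h
    · refine hφ (eq_zero_of_dense_span _ h ?_)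
      rintro _ ⟨a, β, rfl⟩
      simp [hr, hzero]
    · refine hφ (eq_zero_of_dense_span _ h ?_)
      rintro _ ⟨β, a, rfl⟩
      simp [hl a β, hzero]

end
end

section
/- Let E = {(φ, φ̃) : φ ∈ σ(𝒜)}, where φ̃ is the unique functional in σ(𝔄) ∪ {0} satisfying φ(a·β) = φ(β·a) = φ(a)φ̃(β), and let F = {(0, ψ) : ψ ∈ σ(𝔄)} (with E = ∅ if σ(𝒜) = ∅ and F = ∅ if σ(𝔄) = ∅). Then E and F are disjoint and, under the identification of (𝒜⋊𝔄)^(1) with 𝒜^(1) × 𝔄^(1), the spectrum satisfies σ(𝒜⋊𝔄) = E ∪ F. -/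
noncomputable section

open ContinuousLinearMap

variable {A B : Type} [NonUnitalNormedRing A] [NormedSpace ℂ A]
    [IsScalarTower ℂ A A] [SMulCommClass ℂ A A]
    [NonUnitalNormedRing B] [NormedSpace ℂ B] [IsScalarTower ℂ B B] [SMulCommClass ℂ B B]

variable [CompleteSpace A] [CompleteSpace B]

/-- `φ` is a character (nonzero multiplicative continuous linear functional) on the Banach
algebra `C`. -/
def IsCharAlg {C : Type} [NonUnitalNormedRing C] [NormedSpace ℂ C]
    (φ : C →L[ℂ] ℂ) : Prop :=
  φ ≠ 0 ∧ ∀ c d : C, φ (c * d) = φ c * φ d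

/-- Under the identification `(𝒜 ⋊ 𝔄)^(1) ≅ 𝒜^(1) × 𝔄^(1)`,
`⟨(φ, ψ), (a, β)⟩ = φ(a) + ψ(β)`, the pair `p = (φ, ψ)` is a character of `𝒜 ⋊ 𝔄`. -/
def IsCharDup (σ : BiAction A B) (p : (A →L[ℂ] ℂ) × (B →L[ℂ] ℂ)) : Prop :=
  p ≠ 0 ∧ ∀ x y : A × B,
    p.1 (dupMul σ x y).1 + p.2 (dupMul σ x y).2 = (p.1 x.1 + p.2 x.2) * (p.1 y.1 + p.2 y.2)

/-- The set `E = {(φ, φ̃) : φ ∈ σ(𝒜)}` where `φ̃ ∈ σ(𝔄) ∪ {0}` is the unique functional with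
`φ(a·β) = φ(β·a) = φ(a)φ̃(β)`. -/
def Eset (σ : BiAction A B) : Set ((A →L[ℂ] ℂ) × (B →L[ℂ] ℂ)) :=
  {p | IsCharAlg p.1 ∧ (p.2 = 0 ∨ (p.2 ≠ 0 ∧ ∀ β γ : B, p.2 (β * γ) = p.2 β * p.2 γ)) ∧
    ∀ (a : A) (β : B), p.1 (σ.r a β) = p.1 a * p.2 β ∧ p.1 (σ.l β a) = p.1 a * p.2 β}

/-- The set `F = {(0, ψ) : ψ ∈ σ(𝔄)}`. -/
def Fset : Set ((A →L[ℂ] ℂ) × (B →L[ℂ] ℂ)) :=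
  {p | p.1 = 0 ∧ IsCharAlg p.2}

/-- `E` and `F` are disjoint and `σ(𝒜 ⋊ 𝔄) = E ∪ F`. -/
theorem spectrum_dup_eq (σ : BiAction A B) :
    Disjoint (Eset σ) (Fset (A := A) (B := B)) ∧
      {p : (A →L[ℂ] ℂ) × (B →L[ℂ] ℂ) | IsCharDup σ p} = Eset σ ∪ Fset := by
  constructor
  · rw [Set.disjoint_left]
    exact fun p hE hF ↦ hE.1.1 hF.1
  ext ⟨φ, ψ⟩
  constructor
  · rintro ⟨hne, hmul⟩
    have hφ (a b : A) : φ (a * b) = φ a * φ b := by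
      simpa [dupMul] using hmul (a, 0) (b, 0)
    have hψ (β γ : B) : ψ (β * γ) = ψ β * ψ γ := by
      simpa [dupMul] using hmul (0, β) (0, γ)
    have hr (a : A) (β : B) : φ (σ.r a β) = φ a * ψ β := by
      simpa [dupMul] using hmul (a, 0) (0, β)
    have hl (a : A) (β : B) : φ (σ.l β a) = φ a * ψ β := by
      simpa [dupMul, mul_comm] using hmul (0, β) (a, 0)
    by_cases h : φ = 0
    · exact Or.inr ⟨h, fun hψ0 ↦ hne (Prod.ext h hψ0), hψ⟩
    · exact Or.inl ⟨⟨h, hφ⟩, (em (ψ = 0)).imp_right fun hψ0 ↦ ⟨hψ0, hψ⟩,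
        fun a β ↦ ⟨hr a β, hl a β⟩⟩
  · rintro (⟨⟨hne, hφ⟩, hψ, hact⟩ | ⟨h, hne, hψ⟩)
    · have hψ' (β γ : B) : ψ (β * γ) = ψ β * ψ γ := by
        rcases hψ with h | h
        · obtain rfl : ψ = 0 := h
          simp
        · exact h.2 β γ
      refine ⟨fun h0 ↦ hne (congrArg Prod.fst h0), fun x y ↦ ?_⟩
      have hr : φ (σ.r x.1 y.2) = φ x.1 * ψ y.2 := (hact _ _).1
      have hl : φ (σ.l x.2 y.1) = φ y.1 * ψ x.2 := (hact _ _).2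
      have hm : φ (x.1 * y.1) = φ x.1 * φ y.1 := hφ _ _
      simp only [dupMul, map_add, hr, hl, hm, hψ']
      ring
    · obtain rfl : φ = 0 := h
      refine ⟨fun h0 ↦ hne (congrArg Prod.snd h0), fun x y ↦ ?_⟩
      simpa [dupMul] using hψ x.2 y.2

end
end

section
/- The amalgamated duplication 𝒜⋊𝔄 is regular if and only if both 𝒜 and 𝔄 are regular. -/
noncomputable section

open ContinuousLinearMap

variable {A B : Type} [NonUnitalNormedCommRing A] [NormedSpace ℂ A]
    [IsScalarTower ℂ A A] [SMulCommClass ℂ A A]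
    [NonUnitalNormedCommRing B] [NormedSpace ℂ B] [IsScalarTower ℂ B B] [SMulCommClass ℂ B B]
    [CompleteSpace A] [CompleteSpace B]

/-- The amalgamated duplication `𝒜 ⋊ 𝔄` as a topological (non-unital) algebra: the
underlying space is `𝒜 × 𝔄` and the product is `(a, β)(b, γ) = (ab + a·γ + β·b, βγ)`. -/
def Dup (_σ : BiAction A B) : Type := A × B

namespace Dup

variable (σ : BiAction A B)

instance : AddCommGroup (Dup σ) := inferInstanceAs (AddCommGroup (A × B))
instance : TopologicalSpace (Dup σ) := inferInstanceAs (TopologicalSpace (A × B))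
instance : Module ℂ (Dup σ) := inferInstanceAs (Module ℂ (A × B))

instance : Mul (Dup σ) :=
  ⟨fun x y => ((x.1 * y.1 + σ.r x.1 y.2 + σ.l x.2 y.1, x.2 * y.2) : A × B)⟩

instance : NonUnitalNonAssocRing (Dup σ) where
  left_distrib x y z := by
    obtain ⟨x1, x2⟩ := x; obtain ⟨y1, y2⟩ := y; obtain ⟨z1, z2⟩ := z
    show ((x1 * (y1 + z1) + σ.r x1 (y2 + z2) + σ.l x2 (y1 + z1), x2 * (y2 + z2)) : A × B) =
      (x1 * y1 + σ.r x1 y2 + σ.l x2 y1, x2 * y2) + (x1 * z1 + σ.r x1 z2 + σ.l x2 z1, x2 * z2)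
    simp only [Prod.mk_add_mk, Prod.mk.injEq, mul_add, map_add,
      ContinuousLinearMap.add_apply]
    exact ⟨by abel, trivial⟩
  right_distrib x y z := by
    obtain ⟨x1, x2⟩ := x; obtain ⟨y1, y2⟩ := y; obtain ⟨z1, z2⟩ := z
    show (((x1 + y1) * z1 + σ.r (x1 + y1) z2 + σ.l (x2 + y2) z1, (x2 + y2) * z2) : A × B) =
      (x1 * z1 + σ.r x1 z2 + σ.l x2 z1, x2 * z2) + (y1 * z1 + σ.r y1 z2 + σ.l y2 z1, y2 * z2)
    simp only [Prod.mk_add_mk, Prod.mk.injEq, add_mul, map_add,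
      ContinuousLinearMap.add_apply]
    exact ⟨by abel, trivial⟩
  zero_mul x := by
    obtain ⟨x1, x2⟩ := x
    show ((0 * x1 + σ.r 0 x2 + σ.l 0 x1, 0 * x2) : A × B) = ((0, 0) : A × B)
    simp
  mul_zero x := by
    obtain ⟨x1, x2⟩ := x
    show ((x1 * 0 + σ.r x1 0 + σ.l x2 0, x2 * 0) : A × B) = ((0, 0) : A × B)
    simp

end Dup

/-- Regularity of a commutative topological algebra `C`: for every closed subset `E` of the
character space (with the Gelfand, i.e. weak-*, topology) and every character `φ₀ ∉ E` there
is `c ∈ C` with `φ₀(c) ≠ 0` and `φ(c) = 0` for all `φ ∈ E`. -/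
def IsRegularAlg (C : Type) [NonUnitalNonAssocRing C] [TopologicalSpace C]
    [Module ℂ C] : Prop :=
  ∀ E : Set (WeakDual.characterSpace ℂ C), IsClosed E →
    ∀ φ₀ : WeakDual.characterSpace ℂ C, φ₀ ∉ E →
      ∃ c : C, φ₀ c ≠ 0 ∧ ∀ φ ∈ E, φ c = 0

open WeakDual Filter Topology in
/-- Spectrally small elements have a spectrally small preimage under `x ↦ x - x ^ 2`. -/
theorem exists_sub_sq_eq {Q : Type*} [NormedCommRing Q] [NormedAlgebra ℂ Q] [CompleteSpace Q]
    (z : Q) (hz : ∀ χ : characterSpace ℂ Q, ‖χ z‖ ≤ 1 / 16) :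
    ∃ x : Q, x - x ^ 2 = z ∧ ∀ χ : characterSpace ℂ Q, ‖χ x‖ ≤ 4 / 3 * ‖χ z‖ := by
  have hcat : ∀ n, (catalan n : ℝ) ≤ 4 ^ n := fun n => by
    rw [catalan_eq_centralBinom_div]
    exact_mod_cast (Nat.div_le_self _ _).trans (Nat.centralBinom_le_four_pow n)
  have hrad : spectralRadius ℂ z < ENNReal.ofReal (1 / 8) := by
    refine lt_of_le_of_lt (b := ENNReal.ofReal (1 / 16)) ?_ ?_
    · refine iSup₂_le fun k hk => ?_
      obtain ⟨χ, rfl⟩ := CharacterSpace.mem_spectrum_iff_exists.1 hk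
      rw [← enorm_eq_nnnorm, ← ofReal_norm]
      exact ENNReal.ofReal_le_ofReal (hz χ)
    · exact (ENNReal.ofReal_lt_ofReal_iff (by norm_num)).2 (by norm_num)
  have hpow : ∀ᶠ n : ℕ in atTop, ‖z ^ n‖ ≤ (1 / 8) ^ n := by
    filter_upwards [(spectrum.pow_norm_pow_one_div_tendsto_nhds_spectralRadius z).eventually_lt_const
      hrad, eventually_ge_atTop 1] with n hn hn1
    have h := (ENNReal.ofReal_lt_ofReal_iff (by norm_num)).1 hn
    have h2 := pow_le_pow_left₀ (by positivity) h.le n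
    rwa [one_div (n : ℝ), Real.rpow_inv_natCast_pow (norm_nonneg _) (by omega)] at h2
  have hnorm : ∀ n, ‖(catalan n : ℂ) • z ^ n‖ ≤ 4 ^ n * ‖z ^ n‖ := fun n => by
    rw [norm_smul, Complex.norm_natCast]
    gcongr
    exact hcat n
  have hs : Summable fun n : ℕ => ‖(catalan n : ℂ) • z ^ n‖ := by
    refine Summable.of_norm_bounded_eventually_nat
      (g := fun n : ℕ => (1 / 2 : ℝ) ^ n)
      (summable_geometric_of_lt_one (by norm_num) (by norm_num)) ?_
    filter_upwards [hpow] with n hn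
    rw [norm_norm]
    calc _ ≤ _ := hnorm n
      _ ≤ 4 ^ n * (1 / 8) ^ n := by gcongr
      _ = _ := by rw [← mul_pow]; norm_num
  set c : Q := ∑' n, (catalan n : ℂ) • z ^ n with hc
  have hcc : c = 1 + z * c ^ 2 := by
    have h1 := tsum_mul_tsum_eq_tsum_sum_antidiagonal_of_summable_norm hs hs
    rw [sq, h1, hc, hs.of_norm.tsum_eq_zero_add, ← (Summable.tsum_mul_left z)]
    · congr 1
      · simp
      · refine tsum_congr fun n => ?_
        rw [catalan_succ', Nat.cast_sum, Finset.sum_smul, Finset.mul_sum]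
        refine Finset.sum_congr rfl fun p hp => ?_
        rw [← Finset.HasAntidiagonal.mem_antidiagonal.1 hp, smul_mul_smul_comm, mul_smul_comm, Nat.cast_mul]
        congr 1
        ring
    · exact (summable_norm_sum_mul_antidiagonal_of_summable_norm hs hs).of_norm
  refine ⟨z * c, by linear_combination z * hcc, fun χ => ?_⟩
  have hχ : ‖χ c‖ ≤ 4 / 3 := by
    have h1 : χ c = ∑' n, χ ((catalan n : ℂ) • z ^ n) :=
      (CharacterSpace.toCLM χ).map_tsum hs.of_norm
    rw [h1]
    refine tsum_of_norm_bounded (g := fun n : ℕ => (1 / 4 : ℝ) ^ n) ?_ fun n => ?_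
    · convert hasSum_geometric_of_lt_one (r := (1 / 4 : ℝ)) (by norm_num) (by norm_num) using 1
      norm_num
    · rw [map_smul, map_pow, norm_smul, Complex.norm_natCast, norm_pow]
      calc _ ≤ (4 : ℝ) ^ n * (1 / 16) ^ n := by
            gcongr
            · exact hcat n
            · exact hz χ
        _ = _ := by rw [← mul_pow]; norm_num
  rw [map_mul, norm_mul, mul_comm]
  gcongr

open WeakDual in
/-- An element whose values on the hull of the kernel of `T` are zero or large admits an element
that is `0` on its zeros in `T` and `1` on the rest of `T`. -/
theorem exists_eq_zero_or_one {U : Type*} [NormedCommRing U] [NormedAlgebra ℂ U]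
    [CompleteSpace U] (T : Set (characterSpace ℂ U)) (a : U)
    (h : ∀ χ : characterSpace ℂ U, (∀ u, (∀ τ ∈ T, τ u = 0) → χ u = 0) →
      χ a = 0 ∨ 32 ≤ ‖χ a‖) :
    ∃ f : U, ∀ τ ∈ T, (τ a = 0 → τ f = 0) ∧ (32 ≤ ‖τ a‖ → τ f = 1) := by
  let J : Ideal U := ⨅ τ ∈ T, RingHom.ker (CharacterSpace.toAlgHom τ)
  have hJ : ∀ u, u ∈ J ↔ ∀ τ ∈ T, τ u = 0 := fun u => by
    simp only [J, Submodule.mem_iInf, RingHom.mem_ker]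
    rfl
  have hJc : IsClosed (J : Set U) := by
    have : (J : Set U) = ⋂ τ ∈ T, {u | τ u = 0} := by
      ext u
      simp [hJ]
    rw [this]
    exact isClosed_biInter fun τ _ => isClosed_eq (map_continuous τ) continuous_const
  let q : U →ₐ[ℂ] U ⧸ J := Ideal.Quotient.mkₐ ℂ J
  have hval : ∀ χ : characterSpace ℂ (U ⧸ J), χ (q a) = 0 ∨ 32 ≤ ‖χ (q a)‖ := fun χ => by
    let χ' : characterSpace ℂ U :=
      CharacterSpace.equivAlgHom.symm ((CharacterSpace.toAlgHom χ).comp q)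
    refine h χ' fun u hu => ?_
    change χ (q u) = 0
    rw [show q u = 0 from Ideal.Quotient.eq_zero_iff_mem.2 ((hJ u).2 hu), map_zero]
  have hunit : IsUnit (1 - q a) := by
    by_contra hn
    obtain ⟨χ, hχ⟩ := CharacterSpace.exists_apply_eq_zero hn
    rw [map_sub, map_one, sub_eq_zero] at hχ
    rcases hval χ with h0 | h0 <;> rw [← hχ] at h0 <;> norm_num at h0
  obtain ⟨v, hv⟩ := hunit.exists_right_inv
  have hχv : ∀ χ : characterSpace ℂ (U ⧸ J), (1 - χ (q a)) * χ v = 1 := fun χ => by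
    simpa using congrArg χ hv
  have hv0 : ∀ χ : characterSpace ℂ (U ⧸ J), χ (q a) = 0 → χ v = 1 := fun χ h0 => by
    simpa [h0] using hχv χ
  have hv1 : ∀ χ : characterSpace ℂ (U ⧸ J), 32 ≤ ‖χ (q a)‖ → ‖χ v‖ ≤ 1 / 31 := fun χ h0 => by
    have h1 := congrArg norm (hχv χ)
    rw [norm_mul, norm_one] at h1
    have h2 := norm_sub_norm_le (χ (q a)) 1
    rw [norm_sub_rev, norm_one] at h2
    nlinarith [norm_nonneg (χ v)]
  have hvz : ∀ χ : characterSpace ℂ (U ⧸ J), ‖χ v‖ ≤ 1 / 31 → ‖χ (v - v ^ 2)‖ ≤ 1 / 16 :=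
    fun χ h0 => by
      rw [map_sub, map_pow]
      refine (norm_sub_le _ _).trans ?_
      rw [norm_pow]
      nlinarith [norm_nonneg (χ v)]
  obtain ⟨x, hx, hxn⟩ := exists_sub_sq_eq (v - v ^ 2) fun χ => by
    rcases hval χ with h0 | h0
    · simp [hv0 χ h0]
    · exact hvz χ (hv1 χ h0)
  obtain ⟨f, hf⟩ := Ideal.Quotient.mkₐ_surjective ℂ J (1 - (v - x))
  refine ⟨f, fun τ hτ => ?_⟩
  let τq : characterSpace ℂ (U ⧸ J) := CharacterSpace.equivAlgHom.symm
    (Ideal.Quotient.liftₐ J (CharacterSpace.toAlgHom τ) fun u hu => (hJ u).1 hu τ hτ)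
  have hτq : ∀ u, τ u = τq (q u) := fun u => rfl
  have hτf : τ f = 1 - (τq v - τq x) := by
    rw [hτq, show q f = _ from hf]
    simp
  rw [hτf, hτq]
  refine ⟨fun h0 => ?_, fun h0 => ?_⟩
  · have h1 := hxn τq
    have h2 : τq x = 0 := by simpa [hv0 τq h0] using h1
    simp [h2, hv0 τq h0]
  · have h1 := hv1 τq h0
    have h2 := (hxn τq).trans (mul_le_mul_of_nonneg_left (hvz τq h1) (by norm_num))
    have h3 : τq x - τq x ^ 2 = τq v - τq v ^ 2 := by
      simpa using congrArg τq hx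
    have h4 : (τq v - τq x) * (1 - τq v - τq x) = 0 := by linear_combination -h3
    rcases mul_eq_zero.1 h4 with h5 | h5
    · simp [h5]
    · exfalso
      have h6 : (1 : ℂ) = τq v + τq x := by linear_combination h5
      have h7 := norm_add_le (τq v) (τq x)
      rw [← h6, norm_one] at h7
      linarith

section CharacterSpace

open WeakDual

variable {C : Type} [NonUnitalNonAssocRing C] [TopologicalSpace C] [Module ℂ C]

/-- A nonzero multiplicative continuous linear functional, as a point of the character space. -/
def characterOfCLM (f : C →L[ℂ] ℂ) (hne : ∃ x, f x ≠ 0) (hmul : ∀ x y, f (x * y) = f x * f y) :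
    characterSpace ℂ C :=
  ⟨StrongDual.toWeakDual f, fun h => hne.elim fun x hx => hx (DFunLike.congr_fun h x), hmul⟩

theorem exists_character_apply_ne_zero (φ : characterSpace ℂ C) : ∃ c, φ c ≠ 0 := by
  by_contra! h
  exact φ.2.1 (ContinuousLinearMap.ext h)

theorem continuous_character_apply (c : C) : Continuous fun φ : characterSpace ℂ C => φ c :=
  (WeakDual.eval_continuous c).comp continuous_subtype_val

/-- A character outside a Gelfand-closed set is separated from it by finitely many elements. -/
theorem exists_finset_le_norm_sub {E : Set (characterSpace ℂ C)} (hE : IsClosed E)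
    {φ₀ : characterSpace ℂ C} (hφ₀ : φ₀ ∉ E) :
    ∃ (F : Finset C) (ε : C → ℝ), (∀ c, 0 < ε c) ∧ ∀ φ ∈ E, ∃ c ∈ F, ε c ≤ ‖φ c - φ₀ c‖ := by
  have hind : Topology.IsInducing fun (φ : characterSpace ℂ C) (c : C) => φ c :=
    Topology.IsInducing.comp (g := fun (φ : WeakDual ℂ C) (c : C) => φ c) ⟨rfl⟩
      Topology.IsInducing.subtypeVal
  obtain ⟨V, hV, hVE⟩ := hind.isOpen_iff.1 hE.isOpen_compl
  have h0 : (fun c => φ₀ c) ∈ V := by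
    change φ₀ ∈ (fun (φ : characterSpace ℂ C) (c : C) => φ c) ⁻¹' V
    rw [hVE]
    exact hφ₀
  obtain ⟨F, u, hu, hFV⟩ := isOpen_pi_iff.1 hV _ h0
  have hε : ∀ c, ∃ ε > 0, c ∈ F → Metric.ball (φ₀ c) ε ⊆ u c := fun c => by
    by_cases hc : c ∈ F
    · obtain ⟨ε, hε, hb⟩ := Metric.isOpen_iff.1 (hu c hc).1 _ (hu c hc).2
      exact ⟨ε, hε, fun _ => hb⟩
    · exact ⟨1, one_pos, fun h => absurd h hc⟩
  choose ε hε hb using hε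
  refine ⟨F, ε, hε, fun φ hφ => ?_⟩
  by_contra! hlt
  have : φ ∈ (fun (φ : characterSpace ℂ C) (c : C) => φ c) ⁻¹' V :=
    hFV fun c hc => hb c hc (mem_ball_iff_norm.2 (hlt c hc))
  rw [hVE] at this
  exact this hφ

/-- Finite unions of sets cut out by non-strict inequalities between continuous functions are
closed. -/
theorem isClosed_exists_mem_finset_le {X ι : Type*} [TopologicalSpace X] (F : Finset ι)
    {f g : ι → X → ℝ} (hf : ∀ i, Continuous (f i)) (hg : ∀ i, Continuous (g i)) :
    IsClosed {x | ∃ i ∈ F, f i x ≤ g i x} := by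
  have : {x | ∃ i ∈ F, f i x ≤ g i x} = ⋃ i ∈ F, {x | f i x ≤ g i x} := by
    ext x
    simp
  rw [this]
  exact F.finite_toSet.isClosed_biUnion fun i _ => isClosed_le (hf i) (hg i)

end CharacterSpace

section Unitization

open WeakDual

/-- The `ℓ¹` unitization of a commutative normed algebra is a commutative normed ring. -/
instance unitizationNormedCommRing : NormedCommRing (WithLp 1 (Unitization ℂ A)) where
  __ := WithLp.instUnitizationNormedRing
  mul_comm x y := congrArg (WithLp.toLp 1) (mul_comm (WithLp.ofLp x) (WithLp.ofLp y))

/-- In a regular algebra, some element has Gelfand transform `1` wherever that of `a` is not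
small. -/
theorem IsRegularAlg.exists_eq_one (hA : IsRegularAlg A) (a : A) {ε : ℝ} (hε : 0 < ε) :
    ∃ b : A, ∀ φ : characterSpace ℂ A, ε ≤ ‖φ a‖ → φ b = 1 := by
  let ext (φ : A →ₙₐ[ℂ] ℂ) : characterSpace ℂ (WithLp 1 (Unitization ℂ A)) :=
    CharacterSpace.equivAlgHom.symm
      ((Unitization.lift φ).comp (WithLp.unitizationAlgEquiv ℂ).toAlgHom)
  have hext : ∀ (φ : A →ₙₐ[ℂ] ℂ) x, ext φ x = (WithLp.ofLp x).fst + φ (WithLp.ofLp x).snd :=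
    fun φ x => rfl
  have hinr : ∀ (φ : A →ₙₐ[ℂ] ℂ) (x : A), ext φ (WithLp.toLp 1 (x : Unitization ℂ A)) = φ x :=
    fun φ x => by simp [hext]
  let t : ℂ := ((32 / ε : ℝ) : ℂ)
  have ht : ∀ φ : characterSpace ℂ A, ε ≤ ‖φ a‖ → 32 ≤ ‖φ (t • a)‖ := fun φ h => by
    rw [map_smul, norm_smul, Complex.norm_real, Real.norm_of_nonneg (by positivity),
      div_mul_eq_mul_div, le_div_iff₀ hε]
    gcongr
  obtain ⟨f, hf⟩ := exists_eq_zero_or_one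
    (insert (ext 0) {τ | ∃ φ : characterSpace ℂ A, ε ≤ ‖φ a‖ ∧
      τ = ext (CharacterSpace.toNonUnitalAlgHom φ)})
    (WithLp.toLp 1 ((t • a : A) : Unitization ℂ A)) fun χ hχ => by
      refine or_iff_not_imp_left.2 fun hne => ?_
      let ι : A →ₗ[ℂ] WithLp 1 (Unitization ℂ A) :=
        (WithLp.linearEquiv 1 ℂ (Unitization ℂ A)).symm.toLinearMap ∘ₗ Unitization.inrHom ℂ ℂ A
      have hι : Continuous ι := (WithLp.unitization_isometry_inr (𝕜 := ℂ) (A := A)).continuous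
      have hιm : ∀ x y, ι (x * y) = ι x * ι y := fun x y =>
        congrArg (WithLp.toLp 1) (Unitization.inr_mul ℂ x y)
      let φ : characterSpace ℂ A := characterOfCLM
        ((CharacterSpace.toCLM χ).comp ⟨ι, hι⟩) ⟨t • a, hne⟩ fun x y => by
          change χ (ι (x * y)) = χ (ι x) * χ (ι y)
          rw [hιm, map_mul]
      refine ht φ ?_
      by_contra hlt
      obtain ⟨c, hc, hcE⟩ := hA {φ | ε ≤ ‖φ a‖}
        (isClosed_le continuous_const (continuous_character_apply a).norm) φ hlt
      refine hc (hχ _ ?_)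
      rintro τ (rfl | ⟨ψ, hψ, rfl⟩)
      · exact hinr 0 c
      · exact (hinr _ c).trans (hcE ψ hψ)
  have hf0 : (WithLp.ofLp f).fst = 0 := by
    have := (hf (ext 0) (Set.mem_insert _ _)).1 (hinr _ _)
    simpa [hext] using this
  refine ⟨(WithLp.ofLp f).snd, fun φ hφ => ?_⟩
  have := (hf _ (Set.mem_insert_of_mem _ ⟨φ, hφ, rfl⟩)).2 (by rw [hinr]; exact ht φ hφ)
  simpa [hext, hf0] using this

end Unitization

set_option linter.unusedSectionVars false

namespace Dup

open WeakDual

variable {σ : BiAction A B}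

variable (σ) in
/-- The inclusion of the ideal `𝒜`. -/
def inl : A →L[ℂ] Dup σ := ContinuousLinearMap.inl ℂ A B

variable (σ) in
/-- The inclusion of the subalgebra `𝔄`. -/
def inr : B →L[ℂ] Dup σ := ContinuousLinearMap.inr ℂ A B

variable (σ) in
/-- The projection onto `𝒜`. -/
def fst : Dup σ →L[ℂ] A := ContinuousLinearMap.fst ℂ A B

variable (σ) in
/-- The projection onto `𝔄`. -/
def snd : Dup σ →L[ℂ] B := ContinuousLinearMap.snd ℂ A B

theorem fst_inl (a : A) : fst σ (inl σ a) = a := rfl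

theorem snd_inl (a : A) : snd σ (inl σ a) = 0 := rfl

theorem fst_inr (β : B) : fst σ (inr σ β) = 0 := rfl

theorem snd_inr (β : B) : snd σ (inr σ β) = β := rfl

theorem fst_mul (x y : Dup σ) : fst σ (x * y) =
    fst σ x * fst σ y + σ.r (fst σ x) (snd σ y) + σ.l (snd σ x) (fst σ y) := rfl

theorem snd_mul (x y : Dup σ) : snd σ (x * y) = snd σ x * snd σ y := rfl

theorem inl_fst_add_inr_snd (x : Dup σ) : inl σ (fst σ x) + inr σ (snd σ x) = x :=
  Prod.ext (add_zero _) (zero_add _)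

theorem mul_inl (x : Dup σ) (a : A) : x * inl σ a = inl σ (fst σ (x * inl σ a)) :=
  Prod.ext rfl (mul_zero _)

theorem inl_mul_inl (a b : A) : inl σ a * inl σ b = inl σ (a * b) := by
  rw [mul_inl, fst_mul]
  simp [fst_inl, snd_inl]

theorem inr_mul_inr (β γ : B) : inr σ β * inr σ γ = inr σ (β * γ) :=
  Prod.ext (by
    change fst σ (inr σ β * inr σ γ) = 0
    rw [fst_mul]
    simp [fst_inr]) rfl

/-- The character of `𝒜 ⋊ 𝔄` obtained from a character of `𝔄`. -/
def characterOfSnd (ψ : characterSpace ℂ B) : characterSpace ℂ (Dup σ) :=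
  characterOfCLM ((CharacterSpace.toCLM ψ).comp (snd σ))
    ((exists_character_apply_ne_zero ψ).imp' (inr σ) fun _ h => h)
    fun x y => map_mul ψ (snd σ x) (snd σ y)

theorem characterOfSnd_apply (ψ : characterSpace ℂ B) (x : Dup σ) :
    characterOfSnd ψ x = ψ (snd σ x) := rfl

/-- For symmetric actions, every character of `𝒜` extends to `𝒜 ⋊ 𝔄`. -/
theorem exists_character_extension (hsym : ∀ (β : B) (a : A), σ.l β a = σ.r a β)
    (φ : characterSpace ℂ A) : ∃ φ' : characterSpace ℂ (Dup σ), ∀ a, φ' (inl σ a) = φ a := by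
  obtain ⟨a₀, h₀⟩ := exists_character_apply_ne_zero φ
  let f : Dup σ →L[ℂ] ℂ := (CharacterSpace.toCLM φ).comp (fst σ) +
    (φ a₀)⁻¹ • (CharacterSpace.toCLM φ).comp ((σ.l.flip a₀).comp (snd σ))
  have hf : ∀ x, f x = φ (fst σ x) + (φ a₀)⁻¹ * φ (σ.l (snd σ x) a₀) := fun x => rfl
  have hfl : ∀ a, f (inl σ a) = φ a := fun a => by
    rw [hf, fst_inl, snd_inl]
    simp
  have hl : ∀ β b, φ (σ.l β b) = (φ a₀)⁻¹ * φ (σ.l β a₀) * φ b := fun β b => by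
    have h : φ (σ.l β b) * φ a₀ = φ (σ.l β a₀) * φ b := by
      rw [← map_mul, ← map_mul, ← σ.compat_l, ← σ.compat_l, mul_comm]
    field_simp
    linear_combination h
  refine ⟨characterOfCLM f ⟨inl σ a₀, by rwa [hfl]⟩ fun x y => ?_, hfl⟩
  rw [hf, hf, hf, fst_mul, snd_mul, σ.l_mul, map_add, map_add, map_mul, ← hsym,
    hl (snd σ y) (fst σ x), hl (snd σ x) (fst σ y), hl (snd σ x) (σ.l (snd σ y) a₀)]
  ring

/-- A character of `𝒜 ⋊ 𝔄` not vanishing on `𝒜` restricts to a character of `𝒜`. -/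
theorem exists_character_inl (φ : characterSpace ℂ (Dup σ)) {a : A} (ha : φ (inl σ a) ≠ 0) :
    ∃ χ : characterSpace ℂ A, ∀ b, χ b = φ (inl σ b) :=
  ⟨characterOfCLM ((CharacterSpace.toCLM φ).comp (inl σ)) ⟨a, ha⟩ fun x y => by
    change φ (inl σ (x * y)) = φ (inl σ x) * φ (inl σ y)
    rw [← inl_mul_inl, map_mul], fun _ => rfl⟩

/-- A character of `𝒜 ⋊ 𝔄` not vanishing on `𝔄` restricts to a character of `𝔄`. -/
theorem exists_character_inr (φ : characterSpace ℂ (Dup σ)) {β : B} (hβ : φ (inr σ β) ≠ 0) :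
    ∃ χ : characterSpace ℂ B, ∀ γ, χ γ = φ (inr σ γ) :=
  ⟨characterOfCLM ((CharacterSpace.toCLM φ).comp (inr σ)) ⟨β, hβ⟩ fun x y => by
    change φ (inr σ (x * y)) = φ (inr σ x) * φ (inr σ y)
    rw [← inr_mul_inr, map_mul], fun _ => rfl⟩

theorem isRegularAlg_left (hsym : ∀ (β : B) (a : A), σ.l β a = σ.r a β)
    (h : IsRegularAlg (Dup σ)) : IsRegularAlg A := by
  intro E hE φ₀ hφ₀
  obtain ⟨F, ε, hε, hF⟩ := exists_finset_le_norm_sub hE hφ₀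
  choose ext hext using exists_character_extension hsym
  obtain ⟨c, hc, hcE⟩ := h {φ | ∃ a ∈ F, ε a ≤ ‖φ (inl σ a) - φ₀ a‖}
    (isClosed_exists_mem_finset_le F (fun _ => continuous_const) fun _ =>
      ((continuous_character_apply _).sub continuous_const).norm) (ext φ₀) (by
      rintro ⟨a, -, ha⟩
      rw [hext, sub_self, norm_zero] at ha
      exact (hε a).not_ge ha)
  obtain ⟨a₀, h₀⟩ := exists_character_apply_ne_zero φ₀
  refine ⟨fst σ (c * inl σ a₀), ?_, fun φ hφ => ?_⟩
  · rw [← hext, ← mul_inl, map_mul, hext]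
    exact mul_ne_zero hc h₀
  · rw [← hext, ← mul_inl, map_mul, hcE, zero_mul]
    simpa only [Set.mem_ofPred_eq, hext] using hF φ hφ

theorem isRegularAlg_right (h : IsRegularAlg (Dup σ)) : IsRegularAlg B := by
  intro E hE ψ₀ hψ₀
  obtain ⟨F, ε, hε, hF⟩ := exists_finset_le_norm_sub hE hψ₀
  obtain ⟨c, hc, hcE⟩ := h {φ | ∃ β ∈ F, ε β ≤ ‖φ (inr σ β) - ψ₀ β‖}
    (isClosed_exists_mem_finset_le F (fun _ => continuous_const) fun _ =>
      ((continuous_character_apply _).sub continuous_const).norm) (characterOfSnd ψ₀) (by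
      rintro ⟨β, -, hβ⟩
      rw [characterOfSnd_apply, snd_inr, sub_self, norm_zero] at hβ
      exact (hε β).not_ge hβ)
  exact ⟨snd σ c, hc, fun ψ hψ => hcE (characterOfSnd ψ) (hF ψ hψ)⟩

/-- Separation of a character not vanishing on `𝒜` from a closed set. -/
theorem exists_separating_of_inl_ne_zero (hA : IsRegularAlg A)
    {E : Set (characterSpace ℂ (Dup σ))} (hE : IsClosed E) {φ₀ : characterSpace ℂ (Dup σ)}
    (hφ₀ : φ₀ ∉ E) {a₀ : A} (h₀ : φ₀ (inl σ a₀) ≠ 0) :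
    ∃ c, φ₀ c ≠ 0 ∧ ∀ φ ∈ E, φ c = 0 := by
  obtain ⟨F, ε, hε, hF⟩ := exists_finset_le_norm_sub hE hφ₀
  obtain ⟨χ₀, hχ₀⟩ := exists_character_inl φ₀ h₀
  obtain ⟨b, hb, hbE⟩ := hA {χ | ∃ c ∈ F, ε c * ‖χ a₀‖ ≤
      ‖χ (fst σ (c * inl σ a₀)) - φ₀ c * χ a₀‖}
    (isClosed_exists_mem_finset_le F
      (fun _ => continuous_const.mul (continuous_character_apply _).norm) fun _ =>
      ((continuous_character_apply _).sub
        (continuous_const.mul (continuous_character_apply _))).norm) χ₀ (by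
      rintro ⟨c, -, hc⟩
      rw [hχ₀, hχ₀, ← mul_inl, map_mul, sub_self, norm_zero] at hc
      exact (mul_pos (hε c) (norm_pos_iff.2 h₀)).not_ge hc)
  refine ⟨inl σ b, by rwa [← hχ₀], fun φ hφ => ?_⟩
  by_contra hne
  obtain ⟨χ, hχ⟩ := exists_character_inl φ hne
  obtain ⟨c, hcF, hc⟩ := hF φ hφ
  refine hne ((hχ b).symm.trans (hbE χ ⟨c, hcF, ?_⟩))
  rw [hχ, hχ, ← mul_inl, map_mul, ← sub_mul, norm_mul]
  gcongr

/-- An element of `𝔄` can be modified by an element of `𝒜` so as to vanish at all characters that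
are not small on given elements of `𝒜`, while keeping its zeros. -/
theorem exists_eq_zero_of_finset (hA : IsRegularAlg A) (β : B) (F : Finset (Dup σ))
    {ε : Dup σ → ℝ} (hε : ∀ c, 0 < ε c) :
    ∃ d : Dup σ, snd σ d = β ∧ ∀ φ : characterSpace ℂ (Dup σ),
      (φ (inr σ β) ≠ 0 → ∃ c ∈ F, ε c ≤ ‖φ (inl σ (fst σ c))‖) → φ d = 0 := by
  classical
  induction F using Finset.induction_on with
  | empty => exact ⟨inr σ β, rfl, fun φ h => by simpa using h⟩
  | insert c F _ ih =>
    obtain ⟨d, hd, hdF⟩ := ih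
    obtain ⟨b, hb⟩ := hA.exists_eq_one (fst σ c) (hε c)
    refine ⟨d - d * inl σ b, ?_, fun φ hφ => ?_⟩
    · rw [map_sub, snd_mul, snd_inl, mul_zero, sub_zero, hd]
    · rw [map_sub, map_mul]
      by_cases hc : ε c ≤ ‖φ (inl σ (fst σ c))‖
      · obtain ⟨χ, hχ⟩ := exists_character_inl φ (norm_pos_iff.1 ((hε c).trans_le hc))
        rw [← hχ, hb χ (by rwa [hχ]), mul_one, sub_self]
      · rw [hdF φ fun hne => ?_, zero_mul, sub_zero]
        obtain ⟨c', hc', h⟩ := hφ hne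
        rcases Finset.mem_insert.1 hc' with rfl | hc'
        · exact absurd h hc
        · exact ⟨c', hc', h⟩

/-- Separation of a character vanishing on `𝒜` from a closed set. -/
theorem exists_separating_of_inl_eq_zero (hA : IsRegularAlg A) (hB : IsRegularAlg B)
    {E : Set (characterSpace ℂ (Dup σ))} (hE : IsClosed E) {φ₀ : characterSpace ℂ (Dup σ)}
    (hφ₀ : φ₀ ∉ E) (h₀ : ∀ a, φ₀ (inl σ a) = 0) :
    ∃ c, φ₀ c ≠ 0 ∧ ∀ φ ∈ E, φ c = 0 := by
  obtain ⟨F, ε, hε, hF⟩ := exists_finset_le_norm_sub hE hφ₀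
  have hsnd : ∀ c, φ₀ c = φ₀ (inr σ (snd σ c)) := fun c => by
    conv_lhs => rw [← inl_fst_add_inr_snd c, map_add, h₀, zero_add]
  obtain ⟨c₀, hc₀⟩ := exists_character_apply_ne_zero φ₀
  obtain ⟨ψ₀, hψ₀⟩ := exists_character_inr φ₀ (hsnd c₀ ▸ hc₀)
  obtain ⟨β, hβ, hβE⟩ := hB {ψ | ∃ c ∈ F, ε c / 2 ≤ ‖ψ (snd σ c) - φ₀ c‖}
    (isClosed_exists_mem_finset_le F (fun _ => continuous_const) fun _ =>
      ((continuous_character_apply _).sub continuous_const).norm) ψ₀ (by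
      rintro ⟨c, -, hc⟩
      rw [hψ₀, ← hsnd, sub_self, norm_zero] at hc
      exact (half_pos (hε c)).not_ge hc)
  obtain ⟨d, hd, hdE⟩ := exists_eq_zero_of_finset hA β F fun c => half_pos (hε c)
  refine ⟨d, by rwa [hsnd, hd, ← hψ₀], fun φ hφ => hdE φ ?_⟩
  obtain ⟨c, hcF, hc⟩ := hF φ hφ
  by_contra! hne
  obtain ⟨hne, hlt⟩ := hne
  obtain ⟨ψ, hψ⟩ := exists_character_inr φ hne
  refine hne ((hψ β).symm.trans (hβE ψ ⟨c, hcF, ?_⟩))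
  rw [hψ]
  have h1 : φ c - φ₀ c = φ (inl σ (fst σ c)) + (φ (inr σ (snd σ c)) - φ₀ c) := by
    conv_lhs => rw [← inl_fst_add_inr_snd c, map_add, inl_fst_add_inr_snd c]
    ring
  rw [h1] at hc
  linarith [norm_add_le (φ (inl σ (fst σ c))) (φ (inr σ (snd σ c)) - φ₀ c), hlt c hcF]

end Dup

/-- For commutative `𝒜`, `𝔄` with symmetric action, `𝒜 ⋊ 𝔄` is regular
if and only if both `𝒜` and `𝔄` are regular. -/
theorem regular_dup_iff (σ : BiAction A B)
    (hsym : ∀ (β : B) (a : A), σ.l β a = σ.r a β) :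
    IsRegularAlg (Dup σ) ↔ IsRegularAlg A ∧ IsRegularAlg B := by
  refine ⟨fun h => ⟨Dup.isRegularAlg_left hsym h, Dup.isRegularAlg_right h⟩,
    fun ⟨hA, hB⟩ E hE φ₀ hφ₀ => ?_⟩
  by_cases h₀ : ∀ a, φ₀ (Dup.inl σ a) = 0
  · exact Dup.exists_separating_of_inl_eq_zero hA hB hE hφ₀ h₀
  · push Not at h₀
    exact Dup.exists_separating_of_inl_ne_zero hA hE hφ₀ h₀.choose_spec

end
end
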